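/- Let A be a PFSA over a finite alphabet Σ whose induced language model p_A is tight (∑'_{y∈Σ*} p_A(y) = 1), and let ε > 0. Then there exist a ReLU Elman RNN over Σ with hidden-state map h and a nonnegative real matrix E such that every entry of E·h(w) is strictly positive for all w ∈ Σ*, and the language model p_R defined autoregressively by p_R(ā | w) := softmax(log(E·h(w)))_ā for ā ∈ Σ ∪ {EOS} (log entrywise, softmax with inverse temperature 1) and p_R(y) := p_R(EOS | y)·∏_{t=1}^{|y|} p_R(y_t | y_{<t}) satisfies TVD(p_A, p_R) < ε. -/

import Mathlib

/-- A probabilistic finite-state automaton over alphabet `σ` with state set `Q`. -/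
structure PFSA (σ Q : Type) [Fintype σ] [Fintype Q] where
  T : σ → Matrix Q Q ℚ
  init : Q → ℚ
  final : Q → ℚ
  T_nonneg : ∀ a q q', 0 ≤ T a q q'
  init_nonneg : ∀ q, 0 ≤ init q
  final_nonneg : ∀ q, 0 ≤ final q
  init_sum : ∑ q, init q = 1
  out_sum : ∀ q, (∑ a, ∑ q', T a q q') + final q = 1

/-- The prefix-weight row vector `h_A(y) = λᵀ T^(y₁) ⋯ T^(y_T)`. -/
def PFSA.prefixVec {σ Q : Type} [Fintype σ] [Fintype Q] (A : PFSA σ Q) (y : List σ) :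
    Q → ℚ :=
  y.foldl (fun v a => Matrix.vecMul v (A.T a)) A.init

/-- The string probability `p_A(y) = h_A(y) · ρ`. -/
def PFSA.stringProb {σ Q : Type} [Fintype σ] [Fintype Q] (A : PFSA σ Q) (y : List σ) : ℚ :=
  ∑ q, A.prefixVec y q * A.final q

/-- A ReLU Elman RNN over alphabet `σ` with hidden coordinates indexed by `D`,
with rational parameters. -/
structure ElmanRNN (σ D : Type) [Fintype σ] [Fintype D] where
  U : Matrix D D ℚ
  V : Matrix D σ ℚ
  bias : D → ℚ
  init : D → ℚ

/-- One-hot embedding of a symbol. -/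
def oneHot {σ : Type} [DecidableEq σ] (a : σ) : σ → ℚ := fun a' => if a' = a then 1 else 0

/-- The hidden-state map of a ReLU Elman RNN: `h(ε) = η` and
`h(y₁⋯y_t) = ReLU(U h(y₁⋯y_{t−1}) + V e_{y_t} + b)`. -/
def ElmanRNN.hid {σ D : Type} [Fintype σ] [Fintype D] [DecidableEq σ]
    (R : ElmanRNN σ D) (y : List σ) : D → ℚ :=
  y.foldl
    (fun v a => fun d => max 0 ((R.U.mulVec v + R.V.mulVec (oneHot a) + R.bias) d))
    R.init

/-- Softmax with inverse temperature `1` over `Σ ∪ {EOS}` (`none` is `EOS`). -/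
noncomputable def softmaxO {σ : Type} [Fintype σ] (x : Option σ → ℝ) (c : Option σ) : ℝ :=
  Real.exp (x c) / ∑ b, Real.exp (x b)

open Filter Topology

namespace PFSA

variable {σ Q : Type} [Fintype σ] [Fintype Q] (A : PFSA σ Q)

/-- The prefix weight of `w`: the total mass of its prefix-weight vector. -/
def prefixWeight (w : List σ) : ℚ := ∑ q, A.prefixVec w q

/-- The joint weight of reading `w` and then emitting `c`, where `none` means termination. -/
def nextWeight (w : List σ) : Option σ → ℚ
  | none => A.stringProb w
  | some a => A.prefixWeight (w ++ [a])

@[simp]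
lemma prefixVec_nil : A.prefixVec [] = A.init := rfl

lemma prefixVec_concat (w : List σ) (a : σ) :
    A.prefixVec (w ++ [a]) = Matrix.vecMul (A.prefixVec w) (A.T a) := by
  simp [prefixVec]

lemma prefixVec_nonneg (w : List σ) (q : Q) : 0 ≤ A.prefixVec w q := by
  induction w using List.reverseRecOn generalizing q with
  | nil => exact A.init_nonneg q
  | append_singleton w a ih =>
    rw [prefixVec_concat]
    exact Finset.sum_nonneg fun i _ => mul_nonneg (ih i) (A.T_nonneg _ _ _)

lemma prefixWeight_nonneg (w : List σ) : 0 ≤ A.prefixWeight w :=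
  Finset.sum_nonneg fun q _ => A.prefixVec_nonneg w q

lemma stringProb_nonneg (w : List σ) : 0 ≤ A.stringProb w :=
  Finset.sum_nonneg fun q _ => mul_nonneg (A.prefixVec_nonneg w q) (A.final_nonneg q)

lemma nextWeight_nonneg (w : List σ) (c : Option σ) : 0 ≤ A.nextWeight w c := by
  cases c
  · exact A.stringProb_nonneg w
  · exact A.prefixWeight_nonneg _

lemma prefixWeight_concat (w : List σ) (a : σ) :
    A.prefixWeight (w ++ [a]) = ∑ q, A.prefixVec w q * ∑ q', A.T a q q' := by
  simp only [prefixWeight, prefixVec_concat, Matrix.vecMul, dotProduct, Finset.mul_sum]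
  exact Finset.sum_comm

lemma sum_nextWeight (w : List σ) : ∑ c, A.nextWeight w c = A.prefixWeight w := by
  simp only [Fintype.sum_option, nextWeight, prefixWeight_concat, stringProb]
  rw [Finset.sum_comm, ← Finset.sum_add_distrib, prefixWeight]
  refine Finset.sum_congr rfl fun q _ => ?_
  rw [← Finset.mul_sum, ← mul_add, add_comm, A.out_sum, mul_one]

lemma nextWeight_le (w : List σ) (c : Option σ) : A.nextWeight w c ≤ A.prefixWeight w := by
  rw [← A.sum_nextWeight w]
  exact Finset.single_le_sum (fun c _ => A.nextWeight_nonneg w c) (Finset.mem_univ c)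

lemma prefixWeight_append_le (w v : List σ) :
    A.prefixWeight (w ++ v) ≤ A.prefixWeight w := by
  induction v using List.reverseRecOn with
  | nil => simp
  | append_singleton v a ih =>
    rw [← List.append_assoc]
    exact (A.nextWeight_le (w ++ v) (some a)).trans ih

@[simp]
lemma prefixWeight_nil : A.prefixWeight [] = 1 := A.init_sum

lemma prefixVec_le_one (w : List σ) (q : Q) : A.prefixVec w q ≤ 1 :=
  calc A.prefixVec w q ≤ A.prefixWeight w :=
        Finset.single_le_sum (fun q _ => A.prefixVec_nonneg w q) (Finset.mem_univ q)
    _ ≤ 1 := by simpa using A.prefixWeight_append_le [] w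

lemma prefixWeight_take_pos {y : List σ} (hy : 0 < A.stringProb y) (t : ℕ) :
    0 < A.prefixWeight (y.take t) :=
  calc 0 < A.stringProb y := hy
    _ ≤ A.prefixWeight y := A.nextWeight_le y none
    _ = A.prefixWeight (y.take t ++ y.drop t) := by rw [List.take_append_drop]
    _ ≤ A.prefixWeight (y.take t) := A.prefixWeight_append_le _ _

/-- Nonnegative output weights for `toElman`, with smoothing parameter `δ`. -/
noncomputable def elmanOutput (A : PFSA σ Q) (δ : ℝ) : Option σ → Option (Option σ × Q) → ℝ
  | _, none => δ
  | none, some (_, q) => A.final q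
  | some a, some (_, q) => ((∑ q', A.T a q q' : ℚ) : ℝ)

lemma elmanOutput_nonneg (A : PFSA σ Q) {δ : ℝ} (hδ : 0 ≤ δ) (c : Option σ)
    (d : Option (Option σ × Q)) : 0 ≤ A.elmanOutput δ c d := by
  rcases d with _ | ⟨l, q⟩
  · exact hδ
  · cases c with
    | none => exact Rat.cast_nonneg.mpr (A.final_nonneg q)
    | some a => exact Rat.cast_nonneg.mpr (Finset.sum_nonneg fun q' _ => A.T_nonneg a q q')

end PFSA

namespace ElmanRNN

variable {σ D : Type} [Fintype σ] [Fintype D] [DecidableEq σ]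

@[simp]
lemma hid_nil (R : ElmanRNN σ D) : R.hid [] = R.init := rfl

lemma hid_concat (R : ElmanRNN σ D) (w : List σ) (a : σ) (d : D) :
    R.hid (w ++ [a]) d = max 0 (∑ d', R.U d d' * R.hid w d' + R.V d a + R.bias d) := by
  simp [hid, Matrix.mulVec, dotProduct, oneHot]

/-- Relabel the hidden coordinates of an Elman RNN. -/
def reindex {D' : Type} [Fintype D'] (e : D ≃ D') (R : ElmanRNN σ D) : ElmanRNN σ D' where
  U i j := R.U (e.symm i) (e.symm j)
  V i a := R.V (e.symm i) a
  bias i := R.bias (e.symm i)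
  init i := R.init (e.symm i)

lemma hid_reindex {D' : Type} [Fintype D'] (e : D ≃ D') (R : ElmanRNN σ D) (w : List σ)
    (i : D') : (R.reindex e).hid w i = R.hid w (e.symm i) := by
  induction w using List.reverseRecOn generalizing i with
  | nil => rfl
  | append_singleton w a ih =>
    rw [hid_concat, hid_concat, ← Equiv.sum_comp e.symm]
    simp only [ih]
    rfl

end ElmanRNN

namespace PFSA

variable {σ Q : Type} [Fintype σ] [Fintype Q] [DecidableEq σ]

/-- An Elman RNN tracking the prefix-weight vector of `A`. The block `some (l, ·)` holds the
vector if the last symbol read is `l` (`none` if nothing has been read) and vanishes otherwise;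
the coordinate `none` is constantly `1`. -/
def toElman (A : PFSA σ Q) : ElmanRNN σ (Option (Option σ × Q)) where
  U
    | some (some a, q), some (_, q') => A.T a q' q
    | _, _ => 0
  V
    | some (some a, _), b => if a = b then 1 else 0
    | _, _ => 0
  bias
    | none => 1
    | some (none, _) => 0
    | some (some _, _) => -1
  init
    | none => 1
    | some (none, q) => A.init q
    | some (some _, _) => 0

lemma toElman_hid (A : PFSA σ Q) (w : List σ) :
    A.toElman.hid w none = 1 ∧
      ∀ l q, A.toElman.hid w (some (l, q)) = if l = w.getLast? then A.prefixVec w q else 0 := by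
  induction w using List.reverseRecOn with
  | nil =>
    refine ⟨rfl, fun l q => ?_⟩
    cases l <;> simp [toElman]
  | append_singleton w a ih =>
    refine ⟨by simp [ElmanRNN.hid_concat, toElman], fun l q => ?_⟩
    rw [ElmanRNN.hid_concat]
    cases l with
    | none => simp [toElman]
    | some b =>
      have hU_none : A.toElman.U (some (some b, q)) none = 0 := rfl
      have hU_some (l : Option σ) (q' : Q) :
          A.toElman.U (some (some b, q)) (some (l, q')) = A.T b q' q := rfl
      have key : ∑ d, A.toElman.U (some (some b, q)) d * A.toElman.hid w d
          = A.prefixVec (w ++ [b]) q := by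
        rw [Fintype.sum_option, Fintype.sum_prod_type_right, prefixVec_concat]
        simp only [hU_none, hU_some, ih.2, ← Finset.mul_sum, Finset.sum_ite_eq',
          Finset.mem_univ, if_true, zero_mul, zero_add, Matrix.vecMul, dotProduct]
        exact Finset.sum_congr rfl fun q' _ => mul_comm _ _
      rw [key]
      have h0 := A.prefixVec_nonneg (w ++ [b]) q
      have h1 := A.prefixVec_le_one (w ++ [b]) q
      by_cases hb : b = a
      · subst hb
        simp [toElman, h0]
      · simp [toElman, hb, h1]

lemma sum_toElman_hid (A : PFSA σ Q) (w : List σ) (q : Q) :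
    ∑ l, A.toElman.hid w (some (l, q)) = A.prefixVec w q := by
  simp only [toElman_hid, Finset.sum_ite_eq', Finset.mem_univ, if_true]

lemma sum_elmanOutput (A : PFSA σ Q) (δ : ℝ) (w : List σ) (c : Option σ) :
    ∑ d, A.elmanOutput δ c d * (A.toElman.hid w d : ℝ) = A.nextWeight w c + δ := by
  rw [Fintype.sum_option, Fintype.sum_prod_type_right, add_comm]
  cases c with
  | none =>
    simp only [elmanOutput, nextWeight, stringProb, ← Finset.mul_sum, ← Rat.cast_sum,
      sum_toElman_hid, (A.toElman_hid w).1]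
    push_cast
    simp only [mul_comm, mul_one]
  | some a =>
    simp only [elmanOutput, nextWeight, prefixWeight_concat, ← Finset.mul_sum, ← Rat.cast_sum,
      sum_toElman_hid, (A.toElman_hid w).1]
    push_cast
    simp only [mul_comm, mul_one]

end PFSA

lemma softmaxO_log {σ : Type} [Fintype σ] {x : Option σ → ℝ} (hx : ∀ c, 0 < x c)
    (c : Option σ) : softmaxO (fun b => Real.log (x b)) c = x c / ∑ b, x b := by
  simp [softmaxO, Real.exp_log, hx]

/-- The weight of a string under an autoregressive model with conditionals `P`. -/
def autoregressive {σ : Type} (P : List σ → Option σ → ℝ) (y : List σ) : ℝ :=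
  P y none * ∏ t : Fin y.length, P (y.take t.1) (some (y.get t))

section Autoregressive

variable {σ : Type} {P : List σ → Option σ → ℝ}

lemma autoregressive_nonneg (hP : ∀ w c, 0 ≤ P w c) (y : List σ) : 0 ≤ autoregressive P y :=
  mul_nonneg (hP _ _) (Finset.prod_nonneg fun _ _ => hP _ _)

lemma autoregressive_cons (P : List σ → Option σ → ℝ) (a : σ) (y : List σ) :
    autoregressive P (a :: y) =
      P [] (some a) * autoregressive (fun w => P (a :: w)) y := by
  simp only [autoregressive]
  erw [Fin.prod_univ_succ]
  simp
  ring

lemma sum_autoregressive_le_one [Fintype σ] (hP : ∀ w c, 0 ≤ P w c)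
    (hsum : ∀ w, ∑ c, P w c = 1) (s : Finset (List σ)) :
    ∑ y ∈ s, autoregressive P y ≤ 1 := by
  classical
  have key : ∀ (n : ℕ) (P : List σ → Option σ → ℝ), (∀ w c, 0 ≤ P w c) →
      (∀ w, ∑ c, P w c = 1) → ∀ s : Finset (List σ), (∀ y ∈ s, y.length < n) →
      ∑ y ∈ s, autoregressive P y ≤ 1 := by
    intro n
    induction n with
    | zero =>
      intro P _ _ s hs
      rw [Finset.eq_empty_of_forall_notMem fun y hy => Nat.not_lt_zero _ (hs y hy)]
      simp
    | succ n ih =>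
      intro P hP hsum s hs
      let tails (a : σ) : Finset (List σ) := s.preimage (a :: ·) (List.cons_injective.injOn)
      have hsub : s ⊆ insert [] (Finset.univ.biUnion fun a => (tails a).image (a :: ·)) := by
        intro y hy
        cases y with
        | nil => simp
        | cons a y => simp [tails, hy]
      have htails (a : σ) : ∑ y ∈ (tails a).image (a :: ·), autoregressive P y
          ≤ P [] (some a) := by
        rw [Finset.sum_image List.cons_injective.injOn]
        simp only [autoregressive_cons, ← Finset.mul_sum]
        refine mul_le_of_le_one_right (hP _ _)
          (ih (fun w => P (a :: w)) (fun w => hP _) (fun w => hsum _) _ fun y hy => ?_)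
        have := hs (a :: y) (by simpa [tails] using hy)
        simpa using this
      calc ∑ y ∈ s, autoregressive P y
          ≤ ∑ y ∈ insert [] (Finset.univ.biUnion fun a => (tails a).image (a :: ·)),
              autoregressive P y :=
            Finset.sum_le_sum_of_subset_of_nonneg hsub
              fun y _ _ => autoregressive_nonneg hP y
        _ = autoregressive P [] +
              ∑ a, ∑ y ∈ (tails a).image (a :: ·), autoregressive P y := by
            rw [Finset.sum_insert (by simp), Finset.sum_biUnion]
            intro a _ b _ hab
            simp only [Function.onFun, Finset.disjoint_left, Finset.mem_image]
            rintro _ ⟨y, _, rfl⟩ ⟨z, _, h⟩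
            exact hab (List.cons.inj h).1.symm
        _ ≤ P [] none + ∑ a, P [] (some a) :=
            add_le_add (by simp [autoregressive]) (Finset.sum_le_sum fun a _ => htails a)
        _ = 1 := by rw [← Fintype.sum_option, hsum]
  exact key (s.sup List.length + 1) P hP hsum s
    fun y hy => Nat.lt_succ_of_le (Finset.le_sup (f := List.length) hy)

end Autoregressive

lemma prod_range_div_of_ne_zero {K : Type*} [Field K] (f : ℕ → K) (hf : ∀ i, f i ≠ 0) (n : ℕ) :
    ∏ i ∈ Finset.range n, f (i + 1) / f i = f n / f 0 := by
  induction n with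
  | zero => simp [hf 0]
  | succ n ih => rw [Finset.prod_range_succ, ih]; field_simp [hf n, hf 0]

/-- The total variation distance of a probability to a subprobability is at most the mass of
the positive part of the difference. -/
lemma half_tsum_abs_sub_le {ι : Type*} {a b : ι → ℝ} (ha : Summable a) (hb : Summable b)
    (hab : ∑' i, b i ≤ ∑' i, a i) :
    1 / 2 * ∑' i, |a i - b i| ≤ ∑' i, max (a i - b i) 0 := by
  have hsub : Summable fun i => a i - b i := ha.sub hb
  have hmax : Summable fun i => max (a i - b i) 0 := by
    refine Summable.of_norm_bounded hsub.abs fun i => ?_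
    rw [Real.norm_of_nonneg (le_max_right _ _)]
    exact max_le (le_abs_self _) (abs_nonneg _)
  have heq : ∀ i, |a i - b i| = 2 * max (a i - b i) 0 - (a i - b i) := by
    intro i
    rcases le_total (a i - b i) 0 with h | h
    · rw [abs_of_nonpos h, max_eq_right h]; ring
    · rw [abs_of_nonneg h, max_eq_left h]; ring
  simp_rw [heq]
  rw [(hmax.mul_left 2).tsum_sub hsub, ha.tsum_sub hb, tsum_mul_left]
  linarith

namespace PFSA

variable {σ Q : Type} [Fintype σ] [Fintype Q]

/-- The next-symbol distribution of `A`, smoothed by adding `δ` to every weight. -/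
noncomputable def smoothed (A : PFSA σ Q) (δ : ℝ) (w : List σ) (c : Option σ) : ℝ :=
  ((A.nextWeight w c : ℝ) + δ) / ∑ b, ((A.nextWeight w b : ℝ) + δ)

lemma nextWeight_add_pos (A : PFSA σ Q) {δ : ℝ} (hδ : 0 < δ) (w : List σ) (c : Option σ) :
    0 < (A.nextWeight w c : ℝ) + δ :=
  add_pos_of_nonneg_of_pos (Rat.cast_nonneg.mpr (A.nextWeight_nonneg w c)) hδ

lemma smoothed_nonneg (A : PFSA σ Q) {δ : ℝ} (hδ : 0 < δ) (w : List σ) (c : Option σ) :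
    0 ≤ A.smoothed δ w c :=
  div_nonneg (A.nextWeight_add_pos hδ w c).le
    (Finset.sum_nonneg fun b _ => (A.nextWeight_add_pos hδ w b).le)

lemma sum_smoothed (A : PFSA σ Q) {δ : ℝ} (hδ : 0 < δ) (w : List σ) :
    ∑ c, A.smoothed δ w c = 1 := by
  simp only [smoothed, ← Finset.sum_div]
  exact div_self (Finset.sum_pos (fun b _ => A.nextWeight_add_pos hδ w b)
    Finset.univ_nonempty).ne'

lemma tendsto_smoothed (A : PFSA σ Q) {w : List σ} (hw : A.prefixWeight w ≠ 0)
    (c : Option σ) :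
    Tendsto (fun δ => A.smoothed δ w c) (𝓝[>] 0)
      (𝓝 ((A.nextWeight w c : ℝ) / A.prefixWeight w)) := by
  have hsum : ∑ b, ((A.nextWeight w b : ℝ) + 0) = A.prefixWeight w := by
    simp [← A.sum_nextWeight w]
  have hne : ∑ b, ((A.nextWeight w b : ℝ) + 0) ≠ 0 := by
    rw [hsum]; exact_mod_cast hw
  have hcont : ContinuousAt (fun δ => A.smoothed δ w c) 0 := by
    unfold smoothed
    exact ContinuousAt.div (by fun_prop) (by fun_prop) hne
  have h := hcont.tendsto
  rw [show A.smoothed 0 w c = (A.nextWeight w c : ℝ) / A.prefixWeight w by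
    rw [smoothed, hsum, add_zero]] at h
  exact h.mono_left nhdsWithin_le_nhds

lemma tendsto_autoregressive_smoothed (A : PFSA σ Q) {y : List σ}
    (hy : 0 < A.stringProb y) :
    Tendsto (fun δ => autoregressive (A.smoothed δ) y) (𝓝[>] 0)
      (𝓝 (A.stringProb y : ℝ)) := by
  have hpos := A.prefixWeight_take_pos hy
  have hpos_y : A.prefixWeight y ≠ 0 := by simpa using (hpos y.length).ne'
  have hlim := (A.tendsto_smoothed hpos_y none).mul
    (tendsto_finsetProd Finset.univ fun (t : Fin y.length) _ =>
      A.tendsto_smoothed (hpos t).ne' (some (y.get t)))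
  have hprod : ∏ t : Fin y.length, ((A.nextWeight (y.take t) (some (y.get t)) : ℝ) /
      A.prefixWeight (y.take t)) = A.prefixWeight y := by
    calc _ = ∏ t : Fin y.length, ((A.prefixWeight (y.take (t + 1)) : ℝ) /
          A.prefixWeight (y.take t)) := by simp [nextWeight]
      _ = _ := by
        rw [Fin.prod_univ_eq_prod_range (fun t => ((A.prefixWeight (y.take (t + 1)) : ℝ) /
            A.prefixWeight (y.take t))),
          prod_range_div_of_ne_zero (fun t => (A.prefixWeight (y.take t) : ℝ))
            fun i => by exact_mod_cast (hpos i).ne']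
        simp
  have hcast : (A.prefixWeight y : ℝ) ≠ 0 := by exact_mod_cast hpos_y
  rwa [hprod, nextWeight, div_mul_cancel₀ _ hcast] at hlim

lemma tendsto_tsum_max_sub (A : PFSA σ Q) (hA : Summable fun y => (A.stringProb y : ℝ)) :
    Tendsto (fun δ => ∑' y, max ((A.stringProb y : ℝ) - autoregressive (A.smoothed δ) y) 0)
      (𝓝[>] 0) (𝓝 0) := by
  suffices h : Tendsto
      (fun δ => ∑' y, max ((A.stringProb y : ℝ) - autoregressive (A.smoothed δ) y) 0)
      (𝓝[>] 0) (𝓝 (∑' _ : List σ, (0 : ℝ))) by simpa using h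
  refine tendsto_tsum_of_dominated_convergence hA (fun y => ?_) ?_
  · rcases (A.stringProb_nonneg y).eq_or_lt with hy | hy
    · refine tendsto_const_nhds.congr' ?_
      filter_upwards [self_mem_nhdsWithin] with δ hδ
      have := autoregressive_nonneg (A.smoothed_nonneg hδ) y
      simp [← hy, this]
    · simpa using ((A.tendsto_autoregressive_smoothed (y := y) hy).const_sub
        (A.stringProb y : ℝ)).max (tendsto_const_nhds (x := (0 : ℝ)))
  · filter_upwards [self_mem_nhdsWithin] with δ hδ y
    have hR := autoregressive_nonneg (A.smoothed_nonneg hδ) y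
    have hy : (0 : ℝ) ≤ A.stringProb y := Rat.cast_nonneg.mpr (A.stringProb_nonneg y)
    rw [Real.norm_of_nonneg (le_max_right _ _)]
    exact max_le (by linarith) hy

end PFSA

/-- For every PFSA `A` with tight induced LM and every `ε > 0`, there
exist a ReLU Elman RNN with hidden-state map `h` and a nonnegative real output matrix `E`
such that every entry of `E·h(w)` is strictly positive and the autoregressive LM defined
via `p_R(c | w) = softmax(log(E·h(w)))_c` is within total variation distance `ε` of
`p_A`. -/
theorem elman_log_softmax_approximation
    (σ Q : Type) [Fintype σ] [Fintype Q] [DecidableEq σ] (A : PFSA σ Q)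
    (htight : ∑' y : List σ, (A.stringProb y : ℝ) = 1) (ε : ℝ) (hε : 0 < ε) :
    ∃ (D : ℕ) (R : ElmanRNN σ (Fin D)) (E : Option σ → Fin D → ℝ),
      (∀ (c : Option σ) (d : Fin D), 0 ≤ E c d) ∧
      (∀ (w : List σ) (c : Option σ), 0 < ∑ d, E c d * (R.hid w d : ℝ)) ∧
      (1 / 2) * (∑' y : List σ,
        |(A.stringProb y : ℝ) -
          softmaxO (fun b => Real.log (∑ d, E b d * (R.hid y d : ℝ))) none *
            ∏ t : Fin y.length,
              softmaxO (fun b => Real.log (∑ d, E b d * (R.hid (y.take t.1) d : ℝ)))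
                (some (y.get t))|) < ε := by
  have hA : Summable fun y => (A.stringProb y : ℝ) := by
    by_contra h
    rw [tsum_eq_zero_of_not_summable h] at htight
    exact zero_ne_one htight
  obtain ⟨δ, hδε, hδ⟩ := (((A.tendsto_tsum_max_sub hA).eventually_lt_const hε).and
    self_mem_nhdsWithin).exists
  replace hδ : 0 < δ := hδ
  let e := Fintype.equivFin (Option (Option σ × Q))
  have hE (w : List σ) (c : Option σ) : ∑ d, A.elmanOutput δ c (e.symm d) *
      ((A.toElman.reindex e).hid w d : ℝ) = A.nextWeight w c + δ := by
    simp only [ElmanRNN.hid_reindex]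
    rw [Equiv.sum_comp e.symm (fun d => A.elmanOutput δ c d * (A.toElman.hid w d : ℝ)),
      A.sum_elmanOutput]
  refine ⟨_, A.toElman.reindex e, fun c d => A.elmanOutput δ c (e.symm d),
    fun c d => A.elmanOutput_nonneg hδ.le c _, fun w c => ?_, ?_⟩
  · rw [hE]
    exact A.nextWeight_add_pos hδ w c
  · simp only [hE, softmaxO_log (A.nextWeight_add_pos hδ _)]
    have hle := sum_autoregressive_le_one (A.smoothed_nonneg hδ) (A.sum_smoothed hδ)
    have hnn := autoregressive_nonneg (A.smoothed_nonneg hδ)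
    exact (half_tsum_abs_sub_le hA (summable_of_sum_le hnn hle)
      (htight ▸ Real.tsum_le_of_sum_le hnn hle)).trans_lt hδε
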